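/- Let ℋ be a finite-dimensional complex Hilbert space with dim ℋ ≥ 2 and let α, λ, κ ∈ (0,∞). Then: (1) the sandwiched Rényi α-divergence D_{α,α} is continuous on (B(ℋ)×B(ℋ))_{λ,κ} if and only if (1−κ)α < 1; (2) the Petz-type Rényi α-divergence D_{α,1} is continuous on (B(ℋ)×B(ℋ))_{λ,κ} if and only if α ∈ (0, κ+1). -/

import Mathlib

open Filter Set Topology
open scoped ComplexOrder

noncomputable section

namespace QRenyi

attribute [local instance] Classical.propDecidable

variable {ι : Type*} [Fintype ι] [DecidableEq ι]

/-- Apply a real function to the eigenvalues of a Hermitian matrix (functional calculus);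
junk value `0` for non-Hermitian matrices. -/
noncomputable def hermApply (f : ℝ → ℝ) (A : Matrix ι ι ℂ) : Matrix ι ι ℂ :=
  if hA : A.IsHermitian then hA.cfc f else 0

/-- Real power of a positive semidefinite matrix, taken on its support:
`t ↦ t ^ x` is applied to the nonzero eigenvalues and `0` is mapped to `0`.
In particular `matPow A 0` is the support projection of `A`. -/
noncomputable def matPow (A : Matrix ι ι ℂ) (x : ℝ) : Matrix ι ι ℂ :=
  hermApply (fun t => if t = 0 then 0 else t ^ x) A

/-- Logarithm of a positive semidefinite matrix taken on its support
(`Real.log 0 = 0` in Mathlib, matching the convention `log̃ 0 = 0`). -/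
noncomputable def matLog (A : Matrix ι ι ℂ) : Matrix ι ι ℂ :=
  hermApply Real.log A

/-- `supp ρ ≤ supp σ`, expressed (for PSD matrices) as inclusion of kernels. -/
def suppLE (ρ σ : Matrix ι ι ℂ) : Prop :=
  ∀ v : ι → ℂ, σ.mulVec v = 0 → ρ.mulVec v = 0

/-- The Loewner (positive semidefinite) order. -/
def loewnerLE (A B : Matrix ι ι ℂ) : Prop := (B - A).PosSemidef

/-- Real part of the trace. -/
noncomputable def reTrace (A : Matrix ι ι ℂ) : ℝ := A.trace.re

/-- The trace quantity `Tr ((σ^{(1-α)/(2z)} ρ^{α/z} σ^{(1-α)/(2z)})^z)` (a real number). -/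
noncomputable def Qaz (α z : ℝ) (ρ σ : Matrix ι ι ℂ) : ℝ :=
  reTrace (matPow (matPow σ ((1 - α) / (2 * z)) * matPow ρ (α / z) *
    matPow σ ((1 - α) / (2 * z))) z)

/-- The Rényi `(α,z)`-divergence (for `α ≠ 1`), with values in `EReal = ℝ ∪ {±∞}`.
It equals `(α-1)⁻¹ (log Q_{α,z}(ρ‖σ) - log Tr ρ)`; it is `+∞` when `α > 1` and
`supp ρ ≰ supp σ`, and also `+∞` when `α < 1` and `Q_{α,z}(ρ‖σ) = 0`
(i.e. `(α-1)⁻¹ log 0 = +∞`). -/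
noncomputable def Daz (α z : ℝ) (ρ σ : Matrix ι ι ℂ) : EReal :=
  if (suppLE ρ σ ∨ α < 1) ∧ Qaz α z ρ σ ≠ 0 then
    (((α - 1)⁻¹ * (Real.log (Qaz α z ρ σ) - Real.log (reTrace ρ)) : ℝ) : EReal)
  else ⊤

/-- The (normalized) Umegaki relative entropy. -/
noncomputable def DUm (ρ σ : Matrix ι ι ℂ) : EReal :=
  if suppLE ρ σ then
    (((reTrace ρ)⁻¹ * reTrace (ρ * (matLog ρ - matLog σ)) : ℝ) : EReal)
  else ⊤

/-- The Rényi `(α,z)`-divergence, with `D_{1,z} := D^Um`. -/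
noncomputable def Dfull (α z : ℝ) (ρ σ : Matrix ι ι ℂ) : EReal :=
  if α = 1 then DUm ρ σ else Daz α z ρ σ

/-- The max-relative entropy `D_max(ρ‖σ) = log inf {λ > 0 : ρ ≤ λ σ}`. -/
noncomputable def Dmax (ρ σ : Matrix ι ι ℂ) : EReal :=
  if ∃ c : ℝ, 0 < c ∧ loewnerLE ρ (c • σ) then
    ((Real.log (sInf {c : ℝ | 0 < c ∧ loewnerLE ρ (c • σ)}) : ℝ) : EReal)
  else ⊤

/-- The classical quantity `Q_α^cl(ρ‖σ) = ∑_x ρ(x)^α σ(x)^{1-α}` (with `0^t = 0` for `t ≠ 0`). -/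
noncomputable def Qcl {X : Type*} [Fintype X] (α : ℝ) (ρ σ : X → ℝ) : ℝ :=
  ∑ x, ρ x ^ α * σ x ^ (1 - α)

/-- Absolute continuity `ρ ≪ σ` for functions on a finite set. -/
def acl {X : Type*} (ρ σ : X → ℝ) : Prop := ∀ x, σ x = 0 → ρ x = 0

/-- The classical Rényi `α`-divergence, with values in `EReal`; for `α = 1` it is the
(normalized) Kullback-Leibler divergence. -/
noncomputable def Dcl {X : Type*} [Fintype X] (α : ℝ) (ρ σ : X → ℝ) : EReal :=
  if α = 1 then
    (if acl ρ σ then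
      ((((∑ x, ρ x)⁻¹ * ∑ x, ρ x * (Real.log (ρ x) - Real.log (σ x))) : ℝ) : EReal)
     else ⊤)
  else if (acl ρ σ ∨ α < 1) ∧ Qcl α ρ σ ≠ 0 then
    ((((α - 1)⁻¹ * (Real.log (Qcl α ρ σ) - Real.log (∑ x, ρ x))) : ℝ) : EReal)
  else ⊤

/-- The measured Rényi `α`-divergence: supremum over all finite-outcome POVMs. -/
noncomputable def Dmeas (α : ℝ) (ρ σ : Matrix ι ι ℂ) : EReal :=
  ⨆ (k : ℕ) (M : Fin k → Matrix ι ι ℂ)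
    (_ : (∀ i, (M i).PosSemidef) ∧ ∑ i, M i = 1),
    Dcl α (fun i => reTrace (M i * ρ)) (fun i => reTrace (M i * σ))

/-- A `κ`-function: a continuous nonnegative function on `[0,∞)` with
`limsup_{x→0⁺} f(x) x^{-κ} < ∞`. -/
def IsKappaFunction (κ : ℝ) (f : ℝ → ℝ) : Prop :=
  ContinuousOn f (Set.Ici 0) ∧ (∀ x ∈ Set.Ici (0 : ℝ), 0 ≤ f x) ∧
    ∃ M : ℝ, ∀ᶠ x in 𝓝[>] (0 : ℝ), f x ≤ M * x ^ κ

/-- A strict `κ`-function: a `κ`-function with `liminf_{x→0⁺} f(x) x^{-κ} > 0`. -/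
def IsStrictKappaFunction (κ : ℝ) (f : ℝ → ℝ) : Prop :=
  IsKappaFunction κ f ∧ ∃ c : ℝ, 0 < c ∧ ∀ᶠ x in 𝓝[>] (0 : ℝ), c * x ^ κ ≤ f x

/-- Nonzero PSD matrix predicate. -/
def PSDne (A : Matrix ι ι ℂ) : Prop := A.PosSemidef ∧ A ≠ 0


/-- The set `(B(ℋ)×B(ℋ))_{λ,κ}` of pairs of nonzero PSD matrices with `ρ ≤ λ σ^κ`. -/
def BsetLK (n : ℕ) (lam κ : ℝ) :
    Set (Matrix (Fin n) (Fin n) ℂ × Matrix (Fin n) (Fin n) ℂ) :=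
  {p | PSDne p.1 ∧ PSDne p.2 ∧ loewnerLE p.1 (lam • matPow p.2 κ)}

/-- The set `([0,cI]×[0,cI])_{λ,κ}`. -/
def CsetLK (n : ℕ) (lam κ c : ℝ) :
    Set (Matrix (Fin n) (Fin n) ℂ × Matrix (Fin n) (Fin n) ℂ) :=
  {p ∈ BsetLK n lam κ |
    loewnerLE p.1 (c • (1 : Matrix (Fin n) (Fin n) ℂ)) ∧
    loewnerLE p.2 (c • (1 : Matrix (Fin n) (Fin n) ℂ))}

/-- The set `(S(ℋ)×S(ℋ))_{λ,κ}` of pairs of density matrices with `ρ ≤ λ σ^κ`. -/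
def SsetLK (n : ℕ) (lam κ : ℝ) :
    Set (Matrix (Fin n) (Fin n) ℂ × Matrix (Fin n) (Fin n) ℂ) :=
  {p ∈ BsetLK n lam κ | p.1.trace = 1 ∧ p.2.trace = 1}

theorem hermApply_eq_cfc {A : Matrix ι ι ℂ} (hA : A.IsHermitian) (f : ℝ → ℝ) :
    hermApply f A = cfc f A := by
  rw [hermApply, dif_pos hA, hA.cfc_eq]

theorem continuousOn_spectrum (A : Matrix ι ι ℂ) (f : ℝ → ℝ) :
    ContinuousOn f (spectrum ℝ A) :=
  (Matrix.finite_real_spectrum (A := A)).continuousOn f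

theorem nonneg_of_mem_spectrum {A : Matrix ι ι ℂ} (hA : A.PosSemidef) {t : ℝ}
    (ht : t ∈ spectrum ℝ A) : 0 ≤ t := by
  rw [hA.1.spectrum_real_eq_range_eigenvalues] at ht
  obtain ⟨i, rfl⟩ := ht
  exact hA.eigenvalues_nonneg i

theorem hermApply_congr {A : Matrix ι ι ℂ} (hA : A.PosSemidef) {f g : ℝ → ℝ}
    (h : ∀ t, 0 ≤ t → f t = g t) : hermApply f A = hermApply g A := by
  rw [hermApply_eq_cfc hA.1, hermApply_eq_cfc hA.1]
  exact cfc_congr fun t ht => h t (nonneg_of_mem_spectrum hA ht)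

theorem hermApply_mul {A : Matrix ι ι ℂ} (hA : A.IsHermitian) (f g : ℝ → ℝ) :
    hermApply f A * hermApply g A = hermApply (fun t => f t * g t) A := by
  rw [hermApply_eq_cfc hA, hermApply_eq_cfc hA, hermApply_eq_cfc hA,
    cfc_mul f g A (continuousOn_spectrum A f) (continuousOn_spectrum A g)]

theorem hermApply_isHermitian (f : ℝ → ℝ) (A : Matrix ι ι ℂ) :
    (hermApply f A).IsHermitian := by
  by_cases hA : A.IsHermitian
  · rw [hermApply_eq_cfc hA]
    exact cfc_predicate f A
  · rw [hermApply, dif_neg hA]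
    exact Matrix.isHermitian_zero

theorem hermApply_id {A : Matrix ι ι ℂ} (hA : A.IsHermitian) :
    hermApply (fun t => t) A = A := by
  rw [hermApply_eq_cfc hA]
  exact cfc_id' ℝ A hA

theorem hermApply_const_mul {A : Matrix ι ι ℂ} (hA : A.IsHermitian) (c : ℝ) (f : ℝ → ℝ) :
    hermApply (fun t => c * f t) A = c • hermApply f A := by
  rw [hermApply_eq_cfc hA, hermApply_eq_cfc hA,
    cfc_const_mul c f A (continuousOn_spectrum A f)]

theorem hermApply_sub {A : Matrix ι ι ℂ} (hA : A.IsHermitian) (f g : ℝ → ℝ) :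
    hermApply (fun t => f t - g t) A = hermApply f A - hermApply g A := by
  rw [hermApply_eq_cfc hA, hermApply_eq_cfc hA, hermApply_eq_cfc hA,
    cfc_sub f g A (continuousOn_spectrum A f) (continuousOn_spectrum A g)]

theorem hermApply_one {A : Matrix ι ι ℂ} (hA : A.IsHermitian) :
    hermApply (fun _ => 1) A = 1 := by
  rw [hermApply_eq_cfc hA]
  exact cfc_const_one ℝ A hA

theorem posSemidef_hermApply {A : Matrix ι ι ℂ} (hA : A.PosSemidef) {f : ℝ → ℝ}
    (hf : ∀ t, 0 ≤ t → 0 ≤ f t) : (hermApply f A).PosSemidef := by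
  have h := hermApply_congr hA (f := f) (g := fun t => √(f t) * √(f t))
    fun t ht => (Real.mul_self_sqrt (hf t ht)).symm
  rw [h, ← hermApply_mul hA.1]
  nth_rewrite 2 [← (hermApply_isHermitian _ A).eq]
  exact Matrix.posSemidef_self_mul_conjTranspose _

section

open scoped Matrix.Norms.L2Operator

theorem tendsto_hermApply {X : Type*} {l : Filter X} {f : ℝ → ℝ} (hf : ContinuousOn f (Ici 0))
    {a : X → Matrix ι ι ℂ} {A : Matrix ι ι ℂ} (h : Tendsto a l (𝓝 A))
    (ha : ∀ᶠ x in l, (a x).PosSemidef) (hA : A.PosSemidef) :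
    Tendsto (fun x => hermApply f (a x)) l (𝓝 (hermApply f A)) := by
  have hb : ∀ᶠ x in l, ‖a x‖ < ‖A‖ + 1 := h.norm.eventually_lt_const (by linarith)
  have hs : ∀ B : Matrix ι ι ℂ, B.PosSemidef → ‖B‖ < ‖A‖ + 1 →
      spectrum ℝ B ⊆ Icc 0 (‖A‖ + 1) := by
    intro B hB hn t ht
    have h0 := nonneg_of_mem_spectrum hB ht
    refine ⟨h0, ?_⟩
    have h1 := norm_apply_le_norm_cfc (fun x : ℝ => x) B ht (continuousOn_spectrum B _) hB.1
    have h2 : cfc (fun x : ℝ => x) B = B := cfc_id' ℝ B hB.1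
    rw [Real.norm_of_nonneg h0] at h1
    replace h1 := h1.trans_eq (congrArg _ h2)
    linarith
  have key : Tendsto (fun x => cfc f (a x)) l (𝓝 (cfc f A)) := by
    refine Filter.Tendsto.cfc (p := IsSelfAdjoint) (isCompact_Icc (a := 0) (b := ‖A‖ + 1)) f h
      ?_ ?_ (hs A hA (by linarith)) hA.1 (hf.mono Icc_subset_Ici_self)
    · filter_upwards [ha, hb] with x h1 h2 using hs _ h1 h2
    · filter_upwards [ha] with x h1 using h1.1
  rw [hermApply_eq_cfc hA.1]
  refine key.congr' ?_
  filter_upwards [ha] with x h1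
  rw [hermApply_eq_cfc h1.1]

end

theorem matPow_isHermitian (A : Matrix ι ι ℂ) (x : ℝ) : (matPow A x).IsHermitian :=
  hermApply_isHermitian _ A

theorem posSemidef_matPow {A : Matrix ι ι ℂ} (hA : A.PosSemidef) (x : ℝ) :
    (matPow A x).PosSemidef :=
  posSemidef_hermApply hA fun t ht => by split_ifs <;> positivity

theorem matPow_mul {A : Matrix ι ι ℂ} (hA : A.PosSemidef) (x y : ℝ) :
    matPow A x * matPow A y = matPow A (x + y) := by
  rw [matPow, matPow, hermApply_mul hA.1]
  refine hermApply_congr hA fun t ht => ?_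
  split_ifs with h
  · simp
  · rw [Real.rpow_add (lt_of_le_of_ne ht (Ne.symm h))]

theorem matPow_one {A : Matrix ι ι ℂ} (hA : A.IsHermitian) : matPow A 1 = A := by
  conv_rhs => rw [← hermApply_id hA]
  unfold matPow
  congr 1
  ext t
  split_ifs with h <;> simp [h]

theorem matPow_eq_hermApply_rpow (A : Matrix ι ι ℂ) {x : ℝ} (hx : x ≠ 0) :
    matPow A x = hermApply (fun t => t ^ x) A := by
  unfold matPow
  congr 1
  ext t
  split_ifs with h <;> simp [h, hx]

theorem matPow_zero_mul_matPow {A : Matrix ι ι ℂ} (hA : A.PosSemidef) (x : ℝ) :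
    matPow A 0 * matPow A x = matPow A x := by
  rw [matPow_mul hA, zero_add]

theorem matPow_ne_zero {A : Matrix ι ι ℂ} (hA : A.PosSemidef) (h0 : A ≠ 0) (x : ℝ) :
    matPow A x ≠ 0 := by
  intro h
  have h1 := matPow_mul hA x (1 - x)
  rw [h, zero_mul, add_sub_cancel, matPow_one hA.1] at h1
  exact h0 h1.symm

theorem continuousOn_rpow_Ici {x : ℝ} (hx : 0 ≤ x) :
    ContinuousOn (fun t : ℝ => t ^ x) (Ici 0) :=
  (Real.continuous_rpow_const hx).continuousOn

theorem tendsto_matPow {X : Type*} {l : Filter X} {x : ℝ} (hx : 0 < x)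
    {a : X → Matrix ι ι ℂ} {A : Matrix ι ι ℂ} (h : Tendsto a l (𝓝 A))
    (ha : ∀ᶠ i in l, (a i).PosSemidef) (hA : A.PosSemidef) :
    Tendsto (fun i => matPow (a i) x) l (𝓝 (matPow A x)) := by
  simp only [matPow_eq_hermApply_rpow _ hx.ne']
  exact tendsto_hermApply (continuousOn_rpow_Ici hx.le) h ha hA

theorem continuousOn_hermApply {X : Type*} [TopologicalSpace X] {s : Set X} {f : ℝ → ℝ}
    (hf : ContinuousOn f (Ici 0)) {a : X → Matrix ι ι ℂ} (h : ContinuousOn a s)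
    (ha : ∀ x ∈ s, (a x).PosSemidef) : ContinuousOn (fun x => hermApply f (a x)) s :=
  fun x hx => tendsto_hermApply hf (h x hx) (eventually_mem_nhdsWithin.mono ha) (ha x hx)

theorem continuousOn_matPow {X : Type*} [TopologicalSpace X] {s : Set X} {x : ℝ} (hx : 0 < x)
    {a : X → Matrix ι ι ℂ} (h : ContinuousOn a s) (ha : ∀ i ∈ s, (a i).PosSemidef) :
    ContinuousOn (fun i => matPow (a i) x) s :=
  fun i hi => tendsto_matPow hx (h i hi) (eventually_mem_nhdsWithin.mono ha) (ha i hi)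

theorem continuousOn_reTrace {ι : Type*} [Fintype ι] {X : Type*} [TopologicalSpace X] {s : Set X}
    {a : X → Matrix ι ι ℂ} (h : ContinuousOn a s) : ContinuousOn (fun x => reTrace (a x)) s :=
  Complex.continuous_re.comp_continuousOn (continuous_id.matrix_trace.comp_continuousOn h)

theorem reTrace_matPow_pos {A : Matrix ι ι ℂ} (hA : A.PosSemidef) (h0 : A ≠ 0) (x : ℝ) :
    0 < reTrace (matPow A x) := by
  have h1 := posSemidef_matPow hA x
  have h2 := h1.trace_nonneg
  have h3 : (matPow A x).trace ≠ 0 := fun h => matPow_ne_zero hA h0 x (h1.trace_eq_zero_iff.1 h)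
  exact (Complex.pos_iff.1 (lt_of_le_of_ne h2 h3.symm)).1

theorem reTrace_pos {A : Matrix ι ι ℂ} (hA : A.PosSemidef) (h0 : A ≠ 0) : 0 < reTrace A := by
  simpa only [matPow_one hA.1] using reTrace_matPow_pos hA h0 1

/-- The factor `σ ^ x ρ ^ y`. For `x = (1 - α) / (2 z)` and `y = α / (2 z)` its Gram matrix is the
argument of the outer power in `Qaz`. -/
noncomputable def gramFactor (x y : ℝ) (ρ σ : Matrix ι ι ℂ) : Matrix ι ι ℂ :=
  matPow σ x * matPow ρ y

theorem gramFactor_conjTranspose (x y : ℝ) (ρ σ : Matrix ι ι ℂ) :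
    (gramFactor x y ρ σ).conjTranspose = matPow ρ y * matPow σ x := by
  rw [gramFactor, Matrix.conjTranspose_mul, (matPow_isHermitian σ x).eq,
    (matPow_isHermitian ρ y).eq]

theorem Qaz_eq_gramFactor {ρ : Matrix ι ι ℂ} (hρ : ρ.PosSemidef) (σ : Matrix ι ι ℂ)
    (α z : ℝ) :
    Qaz α z ρ σ = reTrace (matPow (gramFactor ((1 - α) / (2 * z)) (α / (2 * z)) ρ σ *
      (gramFactor ((1 - α) / (2 * z)) (α / (2 * z)) ρ σ).conjTranspose) z) := by
  have h : α / z = α / (2 * z) + α / (2 * z) := by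
    rw [← div_div, div_right_comm]; ring
  rw [gramFactor_conjTranspose, gramFactor, Qaz, h, ← matPow_mul hρ]
  simp only [mul_assoc]

section Dominated

variable {n : ℕ} {lam κ : ℝ} {ρ σ : Matrix (Fin n) (Fin n) ℂ}

theorem matPow_zero_mul_matPow_of_mem (h : (ρ, σ) ∈ BsetLK n lam κ) (x : ℝ) :
    matPow σ 0 * matPow ρ x = matPow ρ x := by
  obtain ⟨⟨hρ, -⟩, ⟨hσ, -⟩, hle⟩ := h
  simp only [loewnerLE] at *
  set Q := 1 - matPow σ 0 with hQ
  have hQh : Q.conjTranspose = Q := by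
    rw [hQ, Matrix.conjTranspose_sub, Matrix.conjTranspose_one, (matPow_isHermitian σ 0).eq]
  have hQσ : Q * matPow σ κ = 0 := by
    rw [hQ, sub_mul, one_mul, matPow_zero_mul_matPow hσ, sub_self]
  have h1 := hle.mul_mul_conjTranspose_same Q
  rw [mul_sub, Matrix.mul_smul, hQσ, smul_zero, zero_sub, hQh, neg_mul] at h1
  have h2 := hρ.mul_mul_conjTranspose_same Q
  rw [hQh] at h2
  have h3 : Q * ρ * Q = 0 := by
    rw [← h2.trace_eq_zero_iff]
    have := h1.trace_nonneg
    rw [Matrix.trace_neg] at this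
    exact le_antisymm (neg_nonneg.1 this) h2.trace_nonneg
  have h4 : Q * matPow ρ (1 / 2) = 0 := by
    rw [← Matrix.self_mul_conjTranspose_eq_zero, Matrix.conjTranspose_mul,
      (matPow_isHermitian ρ _).eq, hQh, mul_assoc, ← mul_assoc (matPow ρ _), matPow_mul hρ,
      add_halves, matPow_one hρ.1, ← mul_assoc, h3]
  have h5 : Q * matPow ρ x = 0 := by
    rw [show x = 1 / 2 + (x - 1 / 2) by ring, ← matPow_mul hρ, ← mul_assoc, h4, zero_mul]
  rw [hQ, sub_mul, one_mul, sub_eq_zero] at h5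
  exact h5.symm

theorem matPow_mul_matPow_zero_of_mem (h : (ρ, σ) ∈ BsetLK n lam κ) (x : ℝ) :
    matPow ρ x * matPow σ 0 = matPow ρ x := by
  have := congrArg Matrix.conjTranspose (matPow_zero_mul_matPow_of_mem h x)
  rwa [Matrix.conjTranspose_mul, (matPow_isHermitian ρ x).eq, (matPow_isHermitian σ 0).eq] at this

theorem suppLE_of_mem (h : (ρ, σ) ∈ BsetLK n lam κ) : suppLE ρ σ := by
  intro v hv
  have h1 : ρ * matPow σ 0 = ρ := by
    simpa only [matPow_one h.1.1.1] using matPow_mul_matPow_zero_of_mem h 1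
  have h2 : matPow σ (-1) * σ = matPow σ 0 := by
    have := matPow_mul h.2.1.1 (-1) 1
    rwa [matPow_one h.2.1.1.1, neg_add_cancel] at this
  rw [← h1, ← h2, ← Matrix.mulVec_mulVec, ← Matrix.mulVec_mulVec, hv]
  simp

theorem matPow_mul_gramFactor (h : (ρ, σ) ∈ BsetLK n lam κ) (x y w : ℝ) (hw : w = -x) :
    matPow σ w * gramFactor x y ρ σ = matPow ρ y := by
  rw [gramFactor, ← mul_assoc, matPow_mul h.2.1.1, hw, neg_add_cancel,
    matPow_zero_mul_matPow_of_mem h]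

theorem gramFactor_ne_zero (h : (ρ, σ) ∈ BsetLK n lam κ) (x y : ℝ) :
    gramFactor x y ρ σ ≠ 0 := by
  intro h0
  have := matPow_mul_gramFactor h x y _ rfl
  rw [h0, mul_zero] at this
  exact matPow_ne_zero h.1.1 h.1.2 y this.symm

theorem Qaz_pos (h : (ρ, σ) ∈ BsetLK n lam κ) (α z : ℝ) : 0 < Qaz α z ρ σ := by
  rw [Qaz_eq_gramFactor h.1.1]
  refine reTrace_matPow_pos (Matrix.posSemidef_self_mul_conjTranspose _) ?_ _
  rw [Ne, Matrix.self_mul_conjTranspose_eq_zero]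
  exact gramFactor_ne_zero h _ _

theorem Daz_of_mem (h : (ρ, σ) ∈ BsetLK n lam κ) (α z : ℝ) :
    Daz α z ρ σ = ((α - 1)⁻¹ * (Real.log (Qaz α z ρ σ) - Real.log (reTrace ρ)) : ℝ) :=
  if_pos ⟨Or.inl (suppLE_of_mem h), (Qaz_pos h α z).ne'⟩

theorem norm_gramFactor_apply_le (hlam : 0 ≤ lam) (h : (ρ, σ) ∈ BsetLK n lam κ) (i j : Fin n) :
    ‖gramFactor (-(κ / 2)) (1 / 2) ρ σ i j‖ ≤ √lam := by
  have hσ := h.2.1.1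
  set L := gramFactor (-(κ / 2)) (1 / 2) ρ σ with hL
  have h1 : (lam • matPow σ 0 - L * L.conjTranspose).PosSemidef := by
    have := (show (lam • matPow σ κ - ρ).PosSemidef from h.2.2).mul_mul_conjTranspose_same
      (matPow σ (-(κ / 2)))
    rw [(matPow_isHermitian σ _).eq, mul_sub, sub_mul, Matrix.mul_smul, Matrix.smul_mul,
      matPow_mul hσ, matPow_mul hσ] at this
    rw [gramFactor_conjTranspose, hL, gramFactor, mul_assoc, ← mul_assoc (matPow ρ _),
      matPow_mul h.1.1, add_halves, matPow_one h.1.1.1, ← mul_assoc]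
    convert this using 4
    ring
  have h2 : (1 - matPow σ 0).PosSemidef := by
    rw [← hermApply_one hσ.1, matPow, ← hermApply_sub hσ.1]
    exact posSemidef_hermApply hσ fun t ht => by split_ifs <;> simp
  have h3 := (Complex.le_def.1 (h1.diag_nonneg (i := i))).1
  have h4 := (Complex.le_def.1 (h2.diag_nonneg (i := i))).1
  have h5 : (L * L.conjTranspose) i i = ((∑ k, ‖L i k‖ ^ 2 : ℝ) : ℂ) := by
    simp [Matrix.mul_apply, Complex.mul_conj']
  simp only [Matrix.sub_apply, Matrix.smul_apply, h5, Complex.zero_re, Complex.sub_re,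
    Complex.real_smul, Complex.re_ofReal_mul, Complex.ofReal_re, Matrix.one_apply_eq,
    Complex.one_re] at h3 h4
  have h6 : ‖L i j‖ ^ 2 ≤ ∑ k, ‖L i k‖ ^ 2 :=
    Finset.single_le_sum (f := fun k => ‖L i k‖ ^ 2) (fun _ _ => by positivity)
      (Finset.mem_univ j)
  exact Real.le_sqrt_of_sq_le (by nlinarith)

theorem continuousOn_gramFactor_half (hlam : 0 ≤ lam) (hκ : 0 < κ) {t : ℝ} (ht : t < κ / 2) :
    ContinuousOn (fun p : Matrix (Fin n) (Fin n) ℂ × Matrix (Fin n) (Fin n) ℂ =>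
      gramFactor (-t) (1 / 2) p.1 p.2) (BsetLK n lam κ) := by
  intro p₀ hp₀
  rw [ContinuousWithinAt, tendsto_iff_ultrafilter]
  intro g hg
  have hmem : ∀ᶠ p in (g : Filter _), p ∈ BsetLK n lam κ := hg self_mem_nhdsWithin
  have hgn : (g : Filter _) ≤ 𝓝 p₀ := hg.trans nhdsWithin_le_nhds
  have h1 : Tendsto Prod.fst (g : Filter _) (𝓝 p₀.1) := (continuous_fst.tendsto p₀).mono_left hgn
  have h2 : Tendsto Prod.snd (g : Filter _) (𝓝 p₀.2) := (continuous_snd.tendsto p₀).mono_left hgn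
  have hK : IsCompact (Set.univ.pi fun _ : Fin n => Set.univ.pi fun _ : Fin n =>
      Metric.closedBall (0 : ℂ) √lam) :=
    isCompact_univ_pi fun _ => isCompact_univ_pi fun _ => isCompact_closedBall _ _
  obtain ⟨(L : Matrix (Fin n) (Fin n) ℂ), -, hL⟩ := hK.ultrafilter_le_nhds'
    (g.map fun p => gramFactor (-(κ / 2)) (1 / 2) p.1 p.2) (by
      refine Ultrafilter.mem_map.2 (hmem.mono fun p hp => ?_)
      exact fun i _ j _ => mem_closedBall_zero_iff.2 (norm_gramFactor_apply_le hlam hp i j))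
  replace hL : Tendsto (fun p : Matrix (Fin n) (Fin n) ℂ × Matrix (Fin n) (Fin n) ℂ =>
      gramFactor (-(κ / 2)) (1 / 2) p.1 p.2) g (𝓝 L) := hL
  have hσ : ∀ᶠ p in (g : Filter (Matrix (Fin n) (Fin n) ℂ × Matrix (Fin n) (Fin n) ℂ)),
      p.2.PosSemidef := hmem.mono fun p hp => hp.2.1.1
  have hρ : ∀ᶠ p in (g : Filter (Matrix (Fin n) (Fin n) ℂ × Matrix (Fin n) (Fin n) ℂ)),
      p.1.PosSemidef := hmem.mono fun p hp => hp.1.1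
  have h3 := (tendsto_matPow (half_pos hκ) h2 hσ hp₀.2.1.1).mul hL
  have h4 : matPow p₀.2 (κ / 2) * L = matPow p₀.1 (1 / 2) := by
    refine tendsto_nhds_unique h3 ?_
    refine (tendsto_matPow (by norm_num) h1 hρ hp₀.1.1).congr' ?_
    filter_upwards [hmem] with p hp
    rw [matPow_mul_gramFactor hp _ _ _ (by ring)]
  have h5 := (tendsto_matPow (sub_pos.2 ht) h2 hσ hp₀.2.1.1).mul hL
  have h6 : matPow p₀.2 (κ / 2 - t) * L = gramFactor (-t) (1 / 2) p₀.1 p₀.2 := by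
    rw [gramFactor, ← h4, ← mul_assoc, matPow_mul hp₀.2.1.1, neg_add_eq_sub]
  rw [h6] at h5
  refine h5.congr' ?_
  filter_upwards [hmem] with p hp
  rw [gramFactor, gramFactor, ← mul_assoc, matPow_mul hp.2.1.1]
  congr 2
  ring

theorem continuousOn_gramFactor_of_pos {x y : ℝ} (hx : 0 < x) (hy : 0 < y) :
    ContinuousOn (fun p : Matrix (Fin n) (Fin n) ℂ × Matrix (Fin n) (Fin n) ℂ =>
      gramFactor x y p.1 p.2) (BsetLK n lam κ) :=
  (continuousOn_matPow hx continuousOn_snd fun _ hp => hp.2.1.1).mul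
    (continuousOn_matPow hy continuousOn_fst fun _ hp => hp.1.1)

theorem continuousOn_gramFactor (hlam : 0 ≤ lam) (hκ : 0 < κ) {t y : ℝ} (ht : t < κ / 2)
    (hy : 1 / 2 ≤ y) :
    ContinuousOn (fun p : Matrix (Fin n) (Fin n) ℂ × Matrix (Fin n) (Fin n) ℂ =>
      gramFactor (-t) y p.1 p.2) (BsetLK n lam κ) := by
  refine ((continuousOn_gramFactor_half hlam hκ ht).mul
    (continuousOn_hermApply (continuousOn_rpow_Ici (sub_nonneg.2 hy)) continuousOn_fst
      fun _ hp => hp.1.1)).congr fun p hp => ?_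
  simp only [gramFactor, Pi.mul_apply, mul_assoc]
  congr 1
  rw [matPow, matPow, hermApply_mul hp.1.1.1]
  refine hermApply_congr hp.1.1 fun s hs => ?_
  split_ifs with h
  · simp
  · rw [← Real.rpow_add (lt_of_le_of_ne hs (Ne.symm h)), add_sub_cancel]

theorem continuousOn_Daz {α z : ℝ} (hz : 0 < z)
    (h : ContinuousOn (fun p : Matrix (Fin n) (Fin n) ℂ × Matrix (Fin n) (Fin n) ℂ =>
      gramFactor ((1 - α) / (2 * z)) (α / (2 * z)) p.1 p.2) (BsetLK n lam κ)) :
    ContinuousOn (fun p : Matrix (Fin n) (Fin n) ℂ × Matrix (Fin n) (Fin n) ℂ =>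
      Daz α z p.1 p.2) (BsetLK n lam κ) := by
  have hQ : ContinuousOn (fun p : Matrix (Fin n) (Fin n) ℂ × Matrix (Fin n) (Fin n) ℂ =>
      Qaz α z p.1 p.2) (BsetLK n lam κ) := by
    refine (continuousOn_reTrace (continuousOn_matPow hz
      (h.mul (continuous_id.matrix_conjTranspose.comp_continuousOn h))
      fun p _ => Matrix.posSemidef_self_mul_conjTranspose _)).congr fun p hp => ?_
    exact Qaz_eq_gramFactor hp.1.1 _ _ _
  refine (continuous_coe_real_ereal.comp_continuousOn
    (((hQ.log fun p hp => (Qaz_pos hp α z).ne').sub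
      ((continuousOn_reTrace continuousOn_fst).log
        fun p hp => (reTrace_pos hp.1.1 hp.1.2).ne')).const_mul (α - 1)⁻¹)).congr ?_
  exact fun p hp => Daz_of_mem hp α z

theorem continuousOn_rpow_mul_log {x : ℝ} (hx : 0 < x) :
    ContinuousOn (fun t : ℝ => t ^ x * Real.log t) (Ici 0) := by
  have h := ((Real.continuous_mul_log.comp
    (Real.continuous_rpow_const hx.le)).const_mul x⁻¹).continuousOn (s := Ici 0)
  refine h.congr fun t ht => ?_
  rcases eq_or_lt_of_le (mem_Ici.1 ht) with rfl | ht
  · simp [hx.ne']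
  · simp only [Function.comp, Real.log_rpow ht]
    field_simp

theorem continuousOn_DUm (hlam : 0 ≤ lam) (hκ : 0 < κ) :
    ContinuousOn (fun p : Matrix (Fin n) (Fin n) ℂ × Matrix (Fin n) (Fin n) ℂ =>
      DUm p.1 p.2) (BsetLK n lam κ) := by
  have hκ4 : 0 < κ / 4 := by positivity
  have h1 : ContinuousOn (fun p : Matrix (Fin n) (Fin n) ℂ × Matrix (Fin n) (Fin n) ℂ =>
      p.1 * (matLog p.1 - matLog p.2)) (BsetLK n lam κ) := by
    have hN := continuousOn_gramFactor_half (n := n) hlam hκ (t := κ / 4) (by linarith)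
    refine ((continuousOn_hermApply Real.continuous_mul_log.continuousOn continuousOn_fst
      fun p hp => hp.1.1).sub (((continuousOn_matPow one_half_pos continuousOn_fst
        fun p hp => hp.1.1).mul (continuous_id.matrix_conjTranspose.comp_continuousOn hN)).mul
          (continuousOn_hermApply (continuousOn_rpow_mul_log hκ4) continuousOn_snd
            fun p hp => hp.2.1.1))).congr fun p hp => ?_
    have hρ := hp.1.1
    have hσ := hp.2.1.1
    simp only [Function.comp_apply, id, Pi.sub_apply, Pi.mul_apply]
    rw [gramFactor_conjTranspose, ← hermApply_mul hσ.1, ← matPow_eq_hermApply_rpow _ hκ4.ne',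
      mul_assoc, mul_assoc, ← mul_assoc (matPow p.2 _), matPow_mul hσ, neg_add_cancel,
      ← mul_assoc (matPow p.1 _) (matPow p.2 0), matPow_mul_matPow_zero_of_mem hp, ← mul_assoc,
      matPow_mul hρ, add_halves, matPow_one hρ.1, mul_sub, ← hermApply_mul hρ.1,
      hermApply_id hρ.1]
    rfl
  refine (continuous_coe_real_ereal.comp_continuousOn
    (((continuousOn_reTrace continuousOn_fst).inv₀ fun p hp =>
      (reTrace_pos hp.1.1 hp.1.2).ne').mul (continuousOn_reTrace h1))).congr ?_
  exact fun p hp => if_pos (suppLE_of_mem hp)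

theorem continuousOn_Dfull {α z : ℝ} (hlam : 0 ≤ lam) (hκ : 0 < κ) (hα : 0 < α) (hz : 0 < z)
    (h : 1 < α → z ≤ α ∧ α - 1 < κ * z) :
    ContinuousOn (fun p : Matrix (Fin n) (Fin n) ℂ × Matrix (Fin n) (Fin n) ℂ =>
      Dfull α z p.1 p.2) (BsetLK n lam κ) := by
  rcases lt_trichotomy α 1 with h1 | rfl | h1
  · simp only [Dfull, if_neg h1.ne]
    refine continuousOn_Daz hz (continuousOn_gramFactor_of_pos ?_ (by positivity))
    exact div_pos (by linarith) (by positivity)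
  · simpa only [Dfull, if_true] using continuousOn_DUm hlam hκ
  · obtain ⟨hzα, hlt⟩ := h h1
    simp only [Dfull, if_neg h1.ne']
    refine continuousOn_Daz hz ?_
    rw [show (1 - α) / (2 * z) = -((α - 1) / (2 * z)) by ring]
    refine continuousOn_gramFactor hlam hκ ?_ ?_
    · rw [div_lt_div_iff₀ (by positivity) (by positivity)]
      linarith
    · rw [div_le_div_iff₀ (by positivity) (by positivity)]
      linarith

end Dominated

theorem hermApply_diagonal (f : ℝ → ℝ) (d : ι → ℝ) :
    hermApply f (Matrix.diagonal fun i => (d i : ℂ)) = Matrix.diagonal fun i => (f (d i) : ℂ) := by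
  have hA : (Matrix.diagonal fun i => (d i : ℂ)).IsHermitian :=
    Matrix.isHermitian_diagonal_of_self_adjoint _ (by ext i; simp)
  set q := Lagrange.interpolate
    (Finset.univ.image d ∪ (Matrix.finite_real_spectrum (A := Matrix.diagonal fun i => (d i : ℂ))).toFinset) id f
  have hqe : ∀ t ∈ Finset.univ.image d ∪ (Matrix.finite_real_spectrum
      (A := Matrix.diagonal fun i => (d i : ℂ))).toFinset, q.eval t = f t :=
    fun t ht => Lagrange.eval_interpolate_at_node f (Function.injective_id.injOn) ht
  rw [hermApply_eq_cfc hA, cfc_congr (g := q.eval) (fun t ht => (hqe t (by simp [ht])).symm)]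
  refine (cfc_polynomial q _ hA).trans ?_
  have h1 : (Matrix.diagonal fun i => (d i : ℂ)) = Matrix.diagonalAlgHom ℝ fun i => (d i : ℂ) :=
    rfl
  rw [h1, Polynomial.aeval_algHom_apply, Polynomial.aeval_pi_apply]
  change Matrix.diagonal _ = _
  congr 1
  ext i
  rw [← hqe (d i) (by simp)]
  exact Polynomial.aeval_algebraMap_apply_eq_algebraMap_eval (d i) q

theorem matPow_diagonal (x : ℝ) (d : ι → ℝ) :
    matPow (Matrix.diagonal fun i => (d i : ℂ)) x =
      Matrix.diagonal fun i => ((if d i = 0 then 0 else d i ^ x : ℝ) : ℂ) :=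
  hermApply_diagonal _ d

/-- The rank-one matrix `u uᵀ` of a real vector `u`. -/
noncomputable def outer {ι : Type*} (u : ι → ℝ) : Matrix ι ι ℂ :=
  Matrix.vecMulVec (fun i => (u i : ℂ)) (fun i => (u i : ℂ))

theorem outer_apply {ι : Type*} (u : ι → ℝ) (i j : ι) : outer u i j = (u i : ℂ) * u j := rfl

theorem posSemidef_outer {ι : Type*} [Fintype ι] (u : ι → ℝ) : (outer u).PosSemidef := by
  have := Matrix.posSemidef_vecMulVec_self_star (R := ℂ) (fun i => (u i : ℂ))
  convert this using 1
  rw [outer]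
  congr 1
  ext i
  simp

theorem outer_mul_self {ι : Type*} [Fintype ι] (u : ι → ℝ) : outer u * outer u = (∑ i, u i ^ 2) • outer u := by
  ext i j
  simp only [Matrix.mul_apply, outer_apply, Matrix.smul_apply, Complex.real_smul,
    Complex.ofReal_sum, Finset.sum_mul, Complex.ofReal_pow]
  exact Finset.sum_congr rfl fun k _ => by ring

theorem reTrace_outer {ι : Type*} [Fintype ι] (u : ι → ℝ) : reTrace (outer u) = ∑ i, u i ^ 2 := by
  simp [reTrace, Matrix.trace, outer_apply, sq]

theorem smul_outer {ι : Type*} {c : ℝ} (hc : 0 ≤ c) (u : ι → ℝ) : c • outer u = outer fun i => √c * u i := by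
  ext i j
  have : (c : ℂ) = (√c : ℂ) * √c := by rw [← Complex.ofReal_mul, Real.mul_self_sqrt hc]
  simp only [Matrix.smul_apply, outer_apply, Complex.real_smul, Complex.ofReal_mul]
  rw [this]
  ring

theorem diagonal_mul_outer_mul_diagonal (s u : ι → ℝ) :
    (Matrix.diagonal fun i => (s i : ℂ)) * outer u * (Matrix.diagonal fun i => (s i : ℂ)) =
      outer fun i => s i * u i := by
  ext i j
  simp only [Matrix.mul_diagonal, Matrix.diagonal_mul, outer_apply, Complex.ofReal_mul]
  ring

theorem matPow_outer {u : ι → ℝ} (hu : 0 < ∑ i, u i ^ 2) (x : ℝ) :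
    matPow (outer u) x = (∑ i, u i ^ 2) ^ (x - 1) • outer u := by
  set N := ∑ i, u i ^ 2
  have hA := (posSemidef_outer u).1
  have h1 : cfc (fun t : ℝ => t * t) (outer u) = cfc (fun t : ℝ => N * t) (outer u) := by
    rw [← hermApply_eq_cfc hA, ← hermApply_eq_cfc hA, ← hermApply_mul hA, hermApply_const_mul hA,
      hermApply_id hA, outer_mul_self]
  have h2 := eqOn_of_cfc_eq_cfc h1 (continuousOn_spectrum _ _) (continuousOn_spectrum _ _) hA
  conv_rhs => rw [← hermApply_id hA, ← hermApply_const_mul hA]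
  rw [matPow, hermApply_eq_cfc hA, hermApply_eq_cfc hA]
  refine cfc_congr fun t ht => ?_
  have h3 : t * t = N * t := h2 ht
  split_ifs with h0
  · simp [h0]
  · rw [mul_right_cancel₀ h0 h3, Real.rpow_sub_one hu.ne', div_mul_cancel₀ _ hu.ne']

theorem reTrace_matPow_outer {u : ι → ℝ} (hu : 0 < ∑ i, u i ^ 2) (x : ℝ) :
    reTrace (matPow (outer u) x) = (∑ i, u i ^ 2) ^ x := by
  have h : reTrace (matPow (outer u) x) = (∑ i, u i ^ 2) ^ (x - 1) * reTrace (outer u) := by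
    rw [matPow_outer hu]
    simp [reTrace]
  rw [h, reTrace_outer, Real.rpow_sub_one hu.ne', div_mul_cancel₀ _ hu.ne']

theorem posSemidef_smul_one_sub_outer {u : ι → ℝ} (hu : 0 < ∑ i, u i ^ 2) :
    ((∑ i, u i ^ 2) • (1 : Matrix ι ι ℂ) - outer u).PosSemidef := by
  have h1 := outer_mul_self u
  set N := ∑ i, u i ^ 2
  set B := N • (1 : Matrix ι ι ℂ) - outer u with hB
  have hBh : B.conjTranspose = B := by
    rw [hB, Matrix.conjTranspose_sub, (posSemidef_outer u).1.eq]
    simp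
  have h2 : B = N⁻¹ • (B * B.conjTranspose) := by
    rw [hBh, hB]
    simp only [sub_mul, mul_sub, h1, Matrix.smul_mul, Matrix.mul_smul, one_mul, mul_one, smul_sub,
      smul_smul, inv_mul_cancel_left₀ hu.ne', inv_mul_cancel₀ hu.ne']
    simp
  rw [h2]
  exact (Matrix.posSemidef_self_mul_conjTranspose B).smul (inv_nonneg.2 hu.le)

theorem Qaz_outer_diagonal {α z : ℝ} (d v : ι → ℝ) (hv : 0 < ∑ i, v i ^ 2)
    (hu : 0 < ∑ i, ((if d i = 0 then 0 else d i ^ ((1 - α) / (2 * z))) * v i) ^ 2) :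
    Qaz α z (outer v) (Matrix.diagonal fun i => (d i : ℂ)) =
      ((∑ i, v i ^ 2) ^ (α / z - 1) *
        ∑ i, ((if d i = 0 then 0 else d i ^ ((1 - α) / (2 * z))) * v i) ^ 2) ^ z := by
  have hN : 0 < (∑ i, v i ^ 2) ^ (α / z - 1) := Real.rpow_pos_of_pos hv _
  have hsum (w : ι → ℝ) : ∑ i, (√((∑ i, v i ^ 2) ^ (α / z - 1)) * w i) ^ 2 =
      (∑ i, v i ^ 2) ^ (α / z - 1) * ∑ i, w i ^ 2 := by
    simp only [mul_pow, Real.sq_sqrt hN.le, Finset.mul_sum]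
  rw [Qaz, matPow_outer hv, matPow_diagonal, Matrix.mul_smul, Matrix.smul_mul,
    diagonal_mul_outer_mul_diagonal, smul_outer hN.le, reTrace_matPow_outer, hsum]
  rw [hsum]
  exact mul_pos hN hu

section Path

/-- Eigenvalues `(1, e, …, e)`. -/
noncomputable def pathDiag (n : ℕ) (e : ℝ) (i : Fin n) : ℝ := if (i : ℕ) = 0 then 1 else e

/-- The vector `√c (1, e ^ (κ / 2), …, e ^ (κ / 2))`. -/
noncomputable def pathVec (n : ℕ) (c κ e : ℝ) (i : Fin n) : ℝ :=
  √c * pathDiag n e i ^ (κ / 2)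

/-- A family of pairs with pure `ρ` along which the divergence jumps at `e = 0`. -/
noncomputable def path (n : ℕ) (c κ e : ℝ) :
    Matrix (Fin n) (Fin n) ℂ × Matrix (Fin n) (Fin n) ℂ :=
  (outer (pathVec n c κ e), Matrix.diagonal fun i => (pathDiag n e i : ℂ))

variable {n : ℕ} {c κ e : ℝ}

theorem pathDiag_nonneg (he : 0 ≤ e) (i : Fin n) : 0 ≤ pathDiag n e i := by
  unfold pathDiag
  split_ifs <;> simp [he]

theorem continuous_path (hκ : 0 < κ) : Continuous (path n c κ) := by
  have hd (i : Fin n) : Continuous fun e => pathDiag n e i := by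
    unfold pathDiag
    split_ifs <;> fun_prop
  have hv (i : Fin n) : Continuous fun e => pathVec n c κ e i :=
    continuous_const.mul ((Real.continuous_rpow_const (half_pos hκ).le).comp (hd i))
  refine Continuous.prodMk ?_ ?_
  · exact continuous_matrix fun i j => by
      simp only [outer_apply]
      exact (Complex.continuous_ofReal.comp (hv i)).mul (Complex.continuous_ofReal.comp (hv j))
  · exact Continuous.matrix_diagonal (continuous_pi fun i => Complex.continuous_ofReal.comp (hd i))

theorem pathVec_sq (hc : 0 ≤ c) (he : 0 ≤ e) (i : Fin n) :
    pathVec n c κ e i ^ 2 = c * pathDiag n e i ^ κ := by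
  rw [pathVec, mul_pow, Real.sq_sqrt hc, ← Real.rpow_mul_natCast (pathDiag_nonneg he i)]
  norm_num

theorem le_sum_pathVec_sq (hn : 0 < n) (hc : 0 ≤ c) (he : 0 ≤ e) :
    c ≤ ∑ i, pathVec n c κ e i ^ 2 := by
  refine le_trans ?_ (Finset.single_le_sum (fun _ _ => sq_nonneg _)
    (Finset.mem_univ (⟨0, hn⟩ : Fin n)))
  rw [pathVec_sq hc he]
  simp [pathDiag]

theorem path_mem (hn : 0 < n) (hc : 0 < c) (hκ : 0 < κ) (he : 0 ≤ e) :
    path n c κ e ∈ BsetLK n (n * c) κ := by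
  have hne {A : Matrix (Fin n) (Fin n) ℂ} (h : 0 < reTrace A) : A ≠ 0 := by
    rintro rfl
    simp [reTrace] at h
  refine ⟨⟨posSemidef_outer _, hne ?_⟩, ⟨?_, ?_⟩, ?_⟩
  · rw [path, reTrace_outer]
    exact hc.trans_le (le_sum_pathVec_sq hn hc.le he)
  · refine Matrix.PosSemidef.diagonal fun i => ?_
    exact Complex.zero_le_real.2 (pathDiag_nonneg he i)
  · intro h
    have := congrFun (congrFun h ⟨0, hn⟩) ⟨0, hn⟩
    simp [path, pathDiag] at this
  · have h1 := (posSemidef_smul_one_sub_outer (u := fun _ : Fin n => √c)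
      (by simp only [Real.sq_sqrt hc.le]; simp; positivity)).mul_mul_conjTranspose_same
      (Matrix.diagonal fun i => ((pathDiag n e i ^ (κ / 2) : ℝ) : ℂ))
    have h2 : (Matrix.diagonal fun i => ((pathDiag n e i ^ (κ / 2) : ℝ) : ℂ)).conjTranspose =
        Matrix.diagonal fun i => ((pathDiag n e i ^ (κ / 2) : ℝ) : ℂ) :=
      Matrix.isHermitian_diagonal_of_self_adjoint _ (by ext i; simp)
    rw [h2, mul_sub, sub_mul, diagonal_mul_outer_mul_diagonal, Matrix.mul_smul, Matrix.smul_mul,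
      mul_one, Matrix.diagonal_mul_diagonal] at h1
    simp only [path, loewnerLE]
    rw [matPow_eq_hermApply_rpow _ hκ.ne', hermApply_diagonal]
    convert h1 using 2
    · congr 1
      · simp [Real.sq_sqrt hc.le]
      · congr 1
        ext i
        rw [← Complex.ofReal_mul, ← Real.rpow_add_of_nonneg (pathDiag_nonneg he i)
          (half_pos hκ).le (half_pos hκ).le, add_halves]
    · congr 1
      ext i
      rw [pathVec, mul_comm]

theorem two_mul_le_sum_path (hn : 2 ≤ n) (hc : 0 < c) (he : 0 < e) (he1 : e < 1) {x : ℝ}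
    (hx : 2 * x + κ ≤ 0) :
    2 * c ≤ ∑ i, ((if pathDiag n e i = 0 then 0 else pathDiag n e i ^ x) *
      pathVec n c κ e i) ^ 2 := by
  have h1 : ∀ i : Fin n, c ≤ ((if pathDiag n e i = 0 then 0 else pathDiag n e i ^ x) *
      pathVec n c κ e i) ^ 2 := by
    intro i
    have hp : 0 < pathDiag n e i := by unfold pathDiag; split_ifs <;> linarith
    have hp1 : pathDiag n e i ≤ 1 := by unfold pathDiag; split_ifs <;> linarith
    rw [if_neg hp.ne', mul_pow, pathVec_sq hc.le he.le, ← Real.rpow_mul_natCast hp.le,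
      mul_left_comm, ← Real.rpow_add hp]
    refine le_mul_of_one_le_right hc.le (Real.one_le_rpow_of_pos_of_le_one_of_nonpos hp hp1 ?_)
    push_cast
    linarith
  have h2 := Finset.card_nsmul_le_sum Finset.univ _ c fun i _ => h1 i
  rw [Finset.card_univ, Fintype.card_fin, nsmul_eq_mul] at h2
  have h3 : (2 : ℝ) ≤ n := by exact_mod_cast hn
  nlinarith

theorem pathDiag_zero (i : Fin n) : pathDiag n 0 i = if (i : ℕ) = 0 then 1 else 0 := rfl

theorem sum_path_zero (hn : 0 < n) (hc : 0 < c) (x : ℝ) :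
    ∑ i, ((if pathDiag n 0 i = 0 then 0 else pathDiag n 0 i ^ x) * pathVec n c κ 0 i) ^ 2 = c := by
  rw [Finset.sum_eq_single ⟨0, hn⟩]
  · simp [pathDiag_zero, pathVec, Real.sq_sqrt hc.le]
  · intro i _ hi
    have : (i : ℕ) ≠ 0 := fun h => hi (Fin.ext h)
    simp [pathDiag_zero, this]
  · simp

theorem sum_pathVec_sq_zero (hn : 0 < n) (hc : 0 < c) (hκ : 0 < κ) :
    ∑ i, pathVec n c κ 0 i ^ 2 = c := by
  refine Eq.trans (Finset.sum_congr rfl fun i _ => ?_) (sum_path_zero (κ := κ) hn hc 1)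
  simp only [pathDiag_zero, pathVec]
  split_ifs <;> simp_all [hκ.ne']

theorem not_continuousOn_Daz {lam α z : ℝ} (hn : 2 ≤ n) (hlam : 0 < lam) (hκ : 0 < κ)
    (hα : 1 < α) (hz : 0 < z) (hzα : z ≤ α) (h : κ * z ≤ α - 1) :
    ¬ ContinuousOn (fun p : Matrix (Fin n) (Fin n) ℂ × Matrix (Fin n) (Fin n) ℂ =>
      Daz α z p.1 p.2) (BsetLK n lam κ) := by
  intro hcont
  have hn0 : 0 < n := by omega
  have hnR : (0 : ℝ) < n := by exact_mod_cast hn0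
  obtain ⟨c, hc, rfl⟩ : ∃ c, 0 < c ∧ lam = n * c := ⟨lam / n, by positivity, by field_simp⟩
  have hα1 : α - 1 ≠ 0 := by linarith
  have hr : ContinuousOn (fun p : Matrix (Fin n) (Fin n) ℂ × Matrix (Fin n) (Fin n) ℂ =>
      (α - 1)⁻¹ * (Real.log (Qaz α z p.1 p.2) - Real.log (reTrace p.1)))
      (BsetLK n (n * c) κ) := by
    rw [EReal.isEmbedding_coe.continuousOn_iff]
    exact hcont.congr fun p hp => (Daz_of_mem hp α z).symm
  have hQ : ContinuousOn (fun p : Matrix (Fin n) (Fin n) ℂ × Matrix (Fin n) (Fin n) ℂ =>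
      Real.log (Qaz α z p.1 p.2)) (BsetLK n (n * c) κ) := by
    refine ((hr.const_mul (α - 1)).add ((continuousOn_reTrace continuousOn_fst).log
      fun p hp => (reTrace_pos hp.1.1 hp.1.2).ne')).congr fun p hp => ?_
    simp only [Pi.add_apply]
    rw [mul_inv_cancel_left₀ hα1, sub_add_cancel]
  have hpath := hQ.comp (continuous_path (n := n) (c := c) hκ).continuousOn
    (s := Ici 0) fun e he => path_mem hn0 hc hκ he
  have hlim := (hpath 0 self_mem_Ici).mono_left (nhdsWithin_mono 0 Ioi_subset_Ici_self)
  have hx : 2 * ((1 - α) / (2 * z)) + κ ≤ 0 := by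
    rw [show 2 * ((1 - α) / (2 * z)) + κ = (κ * z - (α - 1)) / z by field_simp; ring]
    exact div_nonpos_of_nonpos_of_nonneg (by linarith) hz.le
  have hαz : 0 ≤ α / z - 1 := sub_nonneg.2 ((one_le_div hz).2 hzα)
  have h0 : Qaz α z (path n c κ 0).1 (path n c κ 0).2 = (c ^ (α / z - 1) * c) ^ z := by
    simp only [path]
    rw [Qaz_outer_diagonal, sum_path_zero hn0 hc, sum_pathVec_sq_zero hn0 hc hκ]
    · rwa [sum_pathVec_sq_zero hn0 hc hκ]
    · rwa [sum_path_zero hn0 hc]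
  have h1 : ∀ e, 0 < e → e < 1 → (c ^ (α / z - 1) * (2 * c)) ^ z ≤
      Qaz α z (path n c κ e).1 (path n c κ e).2 := by
    intro e he he1
    have hV := le_sum_pathVec_sq (κ := κ) hn0 hc.le he.le
    have hU := two_mul_le_sum_path hn hc he he1 hx
    simp only [path]
    rw [Qaz_outer_diagonal _ _ (by linarith) (by linarith)]
    gcongr
  have h2 := ge_of_tendsto (b := Real.log ((c ^ (α / z - 1) * (2 * c)) ^ z)) hlim (by
    filter_upwards [Ioo_mem_nhdsGT one_pos] with e he
    exact Real.log_le_log (by positivity) (h1 e he.1 he.2))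
  simp only [Function.comp_apply, h0] at h2
  rw [Real.log_le_log_iff (by positivity) (by positivity),
    Real.rpow_le_rpow_iff (by positivity) (by positivity) hz,
    mul_le_mul_iff_right₀ (by positivity)] at h2
  linarith

end Path

/-- For `dim ℋ ≥ 2` and `α, λ, κ > 0`: the sandwiched Rényi divergence
`D_{α,α}` is continuous on `(B(ℋ)×B(ℋ))_{λ,κ}` iff `(1-κ)α < 1`, and the Petz-type
divergence `D_{α,1}` is continuous on this set iff `α < κ + 1`. -/
theorem sandwiched_petz_continuity_iff {n : ℕ} (hn : 2 ≤ n) (α lam κ : ℝ)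
    (hα : 0 < α) (hlam : 0 < lam) (hκ : 0 < κ) :
    (ContinuousOn (fun p : Matrix (Fin n) (Fin n) ℂ × Matrix (Fin n) (Fin n) ℂ =>
        Dfull α α p.1 p.2) (BsetLK n lam κ) ↔ (1 - κ) * α < 1) ∧
    (ContinuousOn (fun p : Matrix (Fin n) (Fin n) ℂ × Matrix (Fin n) (Fin n) ℂ =>
        Dfull α 1 p.1 p.2) (BsetLK n lam κ) ↔ α < κ + 1) := by
  have not_cont {z : ℝ} (hα1 : 1 < α) (hz : 0 < z) (hzα : z ≤ α) (h : κ * z ≤ α - 1) :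
      ¬ ContinuousOn (fun p : Matrix (Fin n) (Fin n) ℂ × Matrix (Fin n) (Fin n) ℂ =>
        Dfull α z p.1 p.2) (BsetLK n lam κ) := by
    simpa only [Dfull, if_neg hα1.ne'] using not_continuousOn_Daz hn hlam hκ hα1 hz hzα h
  refine ⟨⟨fun hc => ?_, fun h => ?_⟩, ⟨fun hc => ?_, fun h => ?_⟩⟩
  · by_contra! h
    exact not_cont (by nlinarith [mul_pos hκ hα]) hα le_rfl (by linarith) hc
  · exact continuousOn_Dfull hlam.le hκ hα hα fun _ => ⟨le_rfl, by linarith⟩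
  · by_contra! h
    exact not_cont (by linarith) one_pos (by linarith) (by linarith) hc
  · exact continuousOn_Dfull hlam.le hκ hα one_pos fun h1 => ⟨h1.le, by linarith⟩

end QRenyi

end
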